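/- arXiv:1806.01514 — 5 statements merged into one kernel-verified Lean document; each statement's English description precedes it below -/
import Mathlib

section
/- Under the stated hypotheses, for every real symmetric positive semidefinite n×n matrix U, the integral inequality ∫_K ϖ(τ) x(τ)ᵀ U x(τ) dτ ≥ ϑᵀ (F ⊗ U) ϑ holds, where ϑ = ∫_K ϖ(τ) Fₙ(τ) x(τ) dτ and F = W₀⁻¹. -/
open MeasureTheory Matrix
open scoped Kronecker

/-- `Fₙ(τ) = f(τ) ⊗ Iₙ ∈ ℝ^{dn×n}`. -/
noncomputable def kronColId (d n : ℕ) (f : ℝ → Fin d → ℝ) (τ : ℝ) :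
    Matrix (Fin d × Fin n) (Fin n) ℝ :=
  Matrix.of fun p j => f τ p.1 * (1 : Matrix (Fin n) (Fin n) ℝ) p.2 j

/-- For `U ⪰ 0`: `∫_K ϖ(τ) x(τ)ᵀ U x(τ) dτ ≥ ϑᵀ (W₀⁻¹ ⊗ U) ϑ`
where `ϑ = ∫_K ϖ(τ) Fₙ(τ) x(τ) dτ`. -/
theorem weighted_integral_inequality (d n : ℕ) (K : Set ℝ) (hK : MeasurableSet K)
    (ϖ : ℝ → ℝ) (hϖ : Measurable ϖ) (hϖ0 : ∀ τ, 0 ≤ ϖ τ)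
    (f : ℝ → Fin d → ℝ) (hf : Measurable f)
    (hfi : IntegrableOn (fun τ => ϖ τ * ‖f τ‖ ^ 2) K)
    (W₀ : Matrix (Fin d) (Fin d) ℝ)
    (hW₀ : W₀ = Matrix.of fun i j => ∫ τ in K, ϖ τ * (f τ i * f τ j))
    (hW₀pd : W₀.PosDef)
    (x : ℝ → Fin n → ℝ) (hx : Measurable x)
    (hxi : IntegrableOn (fun τ => ϖ τ * ‖x τ‖ ^ 2) K)
    (ϑ : Fin d × Fin n → ℝ)
    (hϑ : ϑ = fun p => ∫ τ in K, ϖ τ * ((kronColId d n f τ *ᵥ x τ) p))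
    (U : Matrix (Fin n) (Fin n) ℝ) (hU : U.PosSemidef) :
    (∫ τ in K, ϖ τ * (x τ ⬝ᵥ U *ᵥ x τ)) ≥ ϑ ⬝ᵥ (W₀⁻¹ ⊗ₖ U) *ᵥ ϑ := by
  have key : ∀ (u v : ℝ → ℝ) (A B : ℝ → ℝ), Measurable u → Measurable v →
      (∀ τ, |u τ| ≤ A τ) → (∀ τ, |v τ| ≤ B τ) →
      IntegrableOn (fun τ => ϖ τ * A τ ^ 2) K → IntegrableOn (fun τ => ϖ τ * B τ ^ 2) K →
      Integrable (fun τ => ϖ τ * (u τ * v τ)) (volume.restrict K) := by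
    intro u v A B hu hv hA hB hAi hBi
    refine Integrable.mono' (Integrable.add hAi hBi) (by fun_prop) ?_
    refine Filter.Eventually.of_forall fun τ => ?_
    simp only [Pi.add_apply, Real.norm_eq_abs, abs_mul, abs_of_nonneg (hϖ0 τ)]
    rw [← mul_add]
    refine mul_le_mul_of_nonneg_left ?_ (hϖ0 τ)
    have h1 : |u τ| * |v τ| ≤ A τ * B τ :=
      mul_le_mul (hA τ) (hB τ) (abs_nonneg _) ((abs_nonneg _).trans (hA τ))
    nlinarith [sq_nonneg (A τ - B τ), sq_nonneg (A τ), sq_nonneg (B τ)]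
  have hfm : ∀ i, Measurable fun τ => f τ i := fun i => (measurable_pi_apply i).comp hf
  have hxm : ∀ a, Measurable fun τ => x τ a := fun i => (measurable_pi_apply i).comp hx
  have hfb : ∀ i τ, |f τ i| ≤ ‖f τ‖ := fun i τ => norm_le_pi_norm (f τ) i
  have hxb : ∀ i τ, |x τ i| ≤ ‖x τ‖ := fun i τ => norm_le_pi_norm (x τ) i
  have Iff : ∀ i j, Integrable (fun τ => ϖ τ * (f τ i * f τ j)) (volume.restrict K) :=
    fun i j => key _ _ _ _ (hfm i) (hfm j) (hfb i) (hfb j) hfi hfi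
  have Ifx : ∀ i a, Integrable (fun τ => ϖ τ * (f τ i * x τ a)) (volume.restrict K) :=
    fun i a => key _ _ _ _ (hfm i) (hxm a) (hfb i) (hxb a) hfi hxi
  have Ixx : ∀ a b, Integrable (fun τ => ϖ τ * (x τ a * x τ b)) (volume.restrict K) :=
    fun a b => key _ _ _ _ (hxm a) (hxm b) (hxb a) (hxb b) hxi hxi
  have hϑ' : ∀ i a, ∫ τ in K, ϖ τ * (f τ i * x τ a) = ϑ (i, a) := by
    intro i a
    rw [hϑ]
    simp [kronColId, Matrix.mulVec, dotProduct, Matrix.one_apply]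
  have hW' : ∀ i j, ∫ τ in K, ϖ τ * (f τ i * f τ j) = W₀ i j := by
    intro i j; rw [hW₀]; rfl
  obtain ⟨c, hc⟩ : ∃ c : Fin d → Fin n → ℝ, c = fun i a => ∑ j, W₀⁻¹ i j * ϑ (j, a) := ⟨_, rfl⟩
  have hWc : ∀ i a, ∑ j, W₀ i j * c j a = ϑ (i, a) := by
    intro i a
    have h1 : W₀ *ᵥ (W₀⁻¹ *ᵥ fun j => ϑ (j, a)) = fun j => ϑ (j, a) := by
      rw [Matrix.mulVec_mulVec, Matrix.mul_nonsing_inv _ hW₀pd.det_pos.ne'.isUnit,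
        Matrix.one_mulVec]
    have h2 := congrFun h1 i
    rw [hc]
    exact h2
  have hpt : ∀ a b τ, ϖ τ * ((x τ a - ∑ i, c i a * f τ i) * (x τ b - ∑ i, c i b * f τ i))
      = ϖ τ * (x τ a * x τ b) - ∑ i, c i b * (ϖ τ * (f τ i * x τ a))
        - ∑ i, c i a * (ϖ τ * (f τ i * x τ b))
        + ∑ i, ∑ j, c i a * c j b * (ϖ τ * (f τ i * f τ j)) := by
    intro a b τ
    have e1 : ∀ a b, ∑ i, c i b * (ϖ τ * (f τ i * x τ a))
        = ϖ τ * x τ a * ∑ i, c i b * f τ i := by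
      intro a b; rw [Finset.mul_sum]; exact Finset.sum_congr rfl fun i _ => by ring
    have e2 : ∑ i, ∑ j, c i a * c j b * (ϖ τ * (f τ i * f τ j))
        = ϖ τ * ((∑ i, c i a * f τ i) * ∑ i, c i b * f τ i) := by
      rw [Finset.sum_mul_sum, Finset.mul_sum]
      refine Finset.sum_congr rfl fun i _ => ?_
      rw [Finset.mul_sum]; exact Finset.sum_congr rfl fun i _ => by ring
    rw [e1, e1, e2]; ring
  have J1 : ∀ a b, Integrable (fun τ => ∑ i, c i b * (ϖ τ * (f τ i * x τ a)))
      (volume.restrict K) := fun a b =>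
    integrable_finsetSum _ fun i _ => (Ifx i a).const_mul _
  have J2 : ∀ a b, Integrable (fun τ => ∑ i, ∑ j, c i a * c j b * (ϖ τ * (f τ i * f τ j)))
      (volume.restrict K) := fun a b =>
    integrable_finsetSum _ fun i _ => integrable_finsetSum _ fun j _ => (Iff i j).const_mul _
  have Iyy : ∀ a b, Integrable (fun τ => ϖ τ * ((x τ a - ∑ i, c i a * f τ i) *
      (x τ b - ∑ i, c i b * f τ i))) (volume.restrict K) := by
    intro a b
    simp only [hpt]
    exact (((Ixx a b).sub (J1 a b)).sub (J1 b a)).add (J2 a b)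
  have hyy : ∀ a b, ∫ τ in K, ϖ τ * ((x τ a - ∑ i, c i a * f τ i) *
      (x τ b - ∑ i, c i b * f τ i))
      = (∫ τ in K, ϖ τ * (x τ a * x τ b)) - ∑ i, c i b * ϑ (i, a) := by
    intro a b
    have K1 : ∀ a b, ∫ τ in K, ∑ i, c i b * (ϖ τ * (f τ i * x τ a))
        = ∑ i, c i b * ϑ (i, a) := by
      intro a b
      rw [integral_finsetSum _ fun i _ => (Ifx i a).const_mul _]
      simp only [integral_const_mul, hϑ']
    have K2 : ∫ τ in K, ∑ i, ∑ j, c i a * c j b * (ϖ τ * (f τ i * f τ j))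
        = ∑ i, c i a * ϑ (i, b) := by
      rw [integral_finsetSum _ fun i _ => integrable_finsetSum _ fun j _ => (Iff i j).const_mul _]
      refine Finset.sum_congr rfl fun i _ => ?_
      rw [integral_finsetSum _ fun j _ => (Iff i j).const_mul _]
      simp only [integral_const_mul, hW']
      rw [← hWc, Finset.mul_sum]
      exact Finset.sum_congr rfl fun j _ => by ring
    simp only [hpt]
    have L1 : Integrable (fun τ => ϖ τ * (x τ a * x τ b)
        - ∑ i, c i b * (ϖ τ * (f τ i * x τ a))) (volume.restrict K) := (Ixx a b).sub (J1 a b)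
    have L2 : Integrable (fun τ => ϖ τ * (x τ a * x τ b)
        - ∑ i, c i b * (ϖ τ * (f τ i * x τ a)) - ∑ i, c i a * (ϖ τ * (f τ i * x τ b)))
        (volume.restrict K) := L1.sub (J1 b a)
    rw [integral_add L2 (J2 a b), integral_sub L1 (J1 b a), integral_sub (Ixx a b) (J1 a b),
      K1, K1, K2]
    ring
  have hq : ∀ (w : ℝ) (y : Fin n → ℝ), w * (y ⬝ᵥ U *ᵥ y)
      = ∑ a, ∑ b, U a b * (w * (y a * y b)) := by
    intro w y
    simp only [dotProduct, Matrix.mulVec, Finset.mul_sum]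
    exact Finset.sum_congr rfl fun a _ => Finset.sum_congr rfl fun b _ => by ring
  have hint : ∀ y : ℝ → Fin n → ℝ,
      (∀ a b, Integrable (fun τ => ϖ τ * (y τ a * y τ b)) (volume.restrict K)) →
      ∫ τ in K, ϖ τ * (y τ ⬝ᵥ U *ᵥ y τ)
        = ∑ a, ∑ b, U a b * ∫ τ in K, ϖ τ * (y τ a * y τ b) := by
    intro y hy
    simp only [hq]
    have M : ∀ a b, Integrable (fun τ => U a b * (ϖ τ * (y τ a * y τ b))) (volume.restrict K) :=
      fun a b => (hy a b).const_mul _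
    rw [integral_finsetSum _ fun a _ => integrable_finsetSum _ fun b _ => M a b]
    refine Finset.sum_congr rfl fun a _ => ?_
    rw [integral_finsetSum _ fun b _ => M a b]
    simp only [integral_const_mul]
  have hpos : 0 ≤ ∫ τ in K, ϖ τ * ((fun a => x τ a - ∑ i, c i a * f τ i) ⬝ᵥ
      U *ᵥ (fun a => x τ a - ∑ i, c i a * f τ i)) := by
    refine integral_nonneg fun τ => mul_nonneg (hϖ0 τ) ?_
    have := hU.dotProduct_mulVec_nonneg (fun a => x τ a - ∑ i, c i a * f τ i)
    simpa using this
  rw [hint (fun τ a => x τ a - ∑ i, c i a * f τ i) Iyy] at hpos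
  simp only [hyy] at hpos
  simp only [mul_sub, Finset.sum_sub_distrib] at hpos
  rw [hint x Ixx]
  have hfin : ϑ ⬝ᵥ (W₀⁻¹ ⊗ₖ U) *ᵥ ϑ = ∑ a, ∑ b, U a b * ∑ i, c i b * ϑ (i, a) := by
    simp only [dotProduct, Matrix.mulVec, Fintype.sum_prod_type, Matrix.kroneckerMap_apply, hc,
      Finset.mul_sum, Finset.sum_mul]
    rw [Finset.sum_comm]
    refine Finset.sum_congr rfl fun a _ => ?_
    rw [Finset.sum_comm (s := Finset.univ (α := Fin n))]
    refine Finset.sum_congr rfl fun i _ => ?_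
    rw [Finset.sum_comm]
    exact Finset.sum_congr rfl fun b _ => Finset.sum_congr rfl fun j _ => by ring
  rw [hfin]
  linarith
end

section
/- Under the stated hypotheses, for every real symmetric positive semidefinite n×n matrix U and every vector ω ∈ ℝ^{dn}, one has ∫_K ϖ(τ) x(τ)ᵀ U x(τ) dτ ≥ 2 ϑᵀ (I_d ⊗ U) ω − ωᵀ (W₀ ⊗ U) ω. -/
open MeasureTheory Matrix
open scoped Kronecker

theorem aux_int {a b : ℕ} (K : Set ℝ) (ϖ : ℝ → ℝ) (hϖ : Measurable ϖ) (hϖ0 : ∀ τ, 0 ≤ ϖ τ)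
    (f : ℝ → Fin a → ℝ) (hf : Measurable f)
    (hfi : IntegrableOn (fun τ => ϖ τ * ‖f τ‖ ^ 2) K)
    (x : ℝ → Fin b → ℝ) (hx : Measurable x)
    (hxi : IntegrableOn (fun τ => ϖ τ * ‖x τ‖ ^ 2) K) (i : Fin a) (j : Fin b) :
    IntegrableOn (fun τ => ϖ τ * (f τ i * x τ j)) K := by
  have h := hfi.add hxi
  refine Integrable.mono' h ?_ ?_
  · have h1 : Measurable fun τ => f τ i := (measurable_pi_apply i).comp hf
    have h2 : Measurable fun τ => x τ j := (measurable_pi_apply j).comp hx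
    exact (hϖ.mul (h1.mul h2)).aestronglyMeasurable
  · refine Filter.Eventually.of_forall fun τ => ?_
    have h1 := norm_le_pi_norm (f τ) i
    have h2 := norm_le_pi_norm (x τ) j
    have h3 : ‖f τ i‖ * ‖x τ j‖ ≤ ‖f τ‖ ^ 2 + ‖x τ‖ ^ 2 := by
      have := mul_le_mul h1 h2 (norm_nonneg _) (norm_nonneg _)
      nlinarith [sq_nonneg (‖f τ‖ - ‖x τ‖), sq_nonneg (‖f τ‖), sq_nonneg (‖x τ‖)]
    simp only [Pi.add_apply]
    rw [norm_mul, norm_mul, Real.norm_of_nonneg (hϖ0 τ), ← mul_add]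
    exact mul_le_mul_of_nonneg_left h3 (hϖ0 τ)

/-- For `U ⪰ 0` and every `ω ∈ ℝ^{dn}`:
`∫_K ϖ(τ) x(τ)ᵀ U x(τ) dτ ≥ 2 ϑᵀ (I_d ⊗ U) ω − ωᵀ (W₀ ⊗ U) ω`. -/
theorem weighted_integral_inequality_free_vector (d n : ℕ) (K : Set ℝ)
    (hK : MeasurableSet K)
    (ϖ : ℝ → ℝ) (hϖ : Measurable ϖ) (hϖ0 : ∀ τ, 0 ≤ ϖ τ)
    (f : ℝ → Fin d → ℝ) (hf : Measurable f)
    (hfi : IntegrableOn (fun τ => ϖ τ * ‖f τ‖ ^ 2) K)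
    (W₀ : Matrix (Fin d) (Fin d) ℝ)
    (hW₀ : W₀ = Matrix.of fun i j => ∫ τ in K, ϖ τ * (f τ i * f τ j))
    (hW₀pd : W₀.PosDef)
    (x : ℝ → Fin n → ℝ) (hx : Measurable x)
    (hxi : IntegrableOn (fun τ => ϖ τ * ‖x τ‖ ^ 2) K)
    (ϑ : Fin d × Fin n → ℝ)
    (hϑ : ϑ = fun p => ∫ τ in K, ϖ τ * ((kronColId d n f τ *ᵥ x τ) p))
    (U : Matrix (Fin n) (Fin n) ℝ) (hU : U.PosSemidef)
    (ω : Fin d × Fin n → ℝ) :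
    (∫ τ in K, ϖ τ * (x τ ⬝ᵥ U *ᵥ x τ)) ≥
      2 * (ϑ ⬝ᵥ ((1 : Matrix (Fin d) (Fin d) ℝ) ⊗ₖ U) *ᵥ ω)
        - ω ⬝ᵥ (W₀ ⊗ₖ U) *ᵥ ω := by
  have hxx := aux_int K ϖ hϖ hϖ0 x hx hxi x hx hxi
  have hfx := aux_int K ϖ hϖ hϖ0 f hf hfi x hx hxi
  have hff := aux_int K ϖ hϖ hϖ0 f hf hfi f hf hfi
  have hk : ∀ τ (p : Fin d × Fin n), (kronColId d n f τ *ᵥ x τ) p = f τ p.1 * x τ p.2 := by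
    intro τ p
    simp [kronColId, Matrix.mulVec, dotProduct, Matrix.one_apply]
  set v : ℝ → Fin n → ℝ := fun τ j => ∑ i, f τ i * ω (i, j) with hv
  have eA : ∀ τ, ϖ τ * (x τ ⬝ᵥ U *ᵥ x τ) = ∑ a, ∑ b, U a b * (ϖ τ * (x τ a * x τ b)) := by
    intro τ
    simp only [dotProduct, Matrix.mulVec, Finset.mul_sum]
    refine Finset.sum_congr rfl fun a _ => Finset.sum_congr rfl fun b _ => by ring
  have eB : ∀ τ, ϖ τ * (x τ ⬝ᵥ U *ᵥ v τ) =
      ∑ p : Fin d × Fin n, (ϖ τ * (f τ p.1 * x τ p.2)) *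
        ((((1 : Matrix (Fin d) (Fin d) ℝ) ⊗ₖ U) *ᵥ ω) p) := by
    intro τ
    simp only [hv, dotProduct, Matrix.mulVec, Finset.mul_sum, Fintype.sum_prod_type,
      Matrix.kroneckerMap_apply, Matrix.one_apply, ite_mul, one_mul, zero_mul, mul_ite, mul_zero]
    rw [Finset.sum_comm]
    conv_rhs => rw [Finset.sum_comm]
    rw [Finset.sum_comm]
    refine Finset.sum_congr rfl fun a _ => ?_
    rw [Finset.sum_comm]
    refine Finset.sum_congr rfl fun b _ => ?_
    rw [Finset.sum_comm]
    simp only [Finset.sum_ite_eq, Finset.mem_univ, if_true]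
    refine Finset.sum_congr rfl fun c _ => by ring
  have eC : ∀ τ, ϖ τ * (v τ ⬝ᵥ U *ᵥ v τ) =
      ∑ p : Fin d × Fin n, ∑ q : Fin d × Fin n,
        (ω p * U p.2 q.2 * ω q) * (ϖ τ * (f τ p.1 * f τ q.1)) := by
    intro τ
    simp only [hv, dotProduct, Matrix.mulVec, Finset.mul_sum, Finset.sum_mul,
      Fintype.sum_prod_type_right]
    refine Finset.sum_congr rfl fun a _ => ?_
    conv_rhs => rw [Finset.sum_comm]
    refine Finset.sum_congr rfl fun b _ => ?_
    rw [Finset.sum_comm]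
    refine Finset.sum_congr rfl fun i _ => Finset.sum_congr rfl fun j _ => by ring
  have iA : IntegrableOn (fun τ => ϖ τ * (x τ ⬝ᵥ U *ᵥ x τ)) K := by
    simp only [eA]
    exact integrable_finsetSum _ fun a _ => integrable_finsetSum _ fun b _ => (hxx a b).const_mul _
  have iB : IntegrableOn (fun τ => ϖ τ * (x τ ⬝ᵥ U *ᵥ v τ)) K := by
    simp only [eB]
    exact integrable_finsetSum _ fun p _ => (hfx p.1 p.2).mul_const _
  have iC : IntegrableOn (fun τ => ϖ τ * (v τ ⬝ᵥ U *ᵥ v τ)) K := by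
    simp only [eC]
    exact integrable_finsetSum _ fun p _ => integrable_finsetSum _ fun q _ =>
      (hff p.1 q.1).const_mul _
  have vB : ϑ ⬝ᵥ ((1 : Matrix (Fin d) (Fin d) ℝ) ⊗ₖ U) *ᵥ ω =
      ∫ τ in K, ϖ τ * (x τ ⬝ᵥ U *ᵥ v τ) := by
    simp only [eB]
    rw [integral_finsetSum _ fun p _ => (hfx p.1 p.2).mul_const _]
    simp only [integral_mul_const, hϑ, hk]
    rfl
  have vC : ω ⬝ᵥ (W₀ ⊗ₖ U) *ᵥ ω = ∫ τ in K, ϖ τ * (v τ ⬝ᵥ U *ᵥ v τ) := by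
    simp only [eC]
    rw [integral_finsetSum _ fun p _ => integrable_finsetSum _ fun q _ =>
      (hff p.1 q.1).const_mul _]
    simp only [dotProduct, Matrix.mulVec, Finset.mul_sum]
    refine Finset.sum_congr rfl fun p _ => ?_
    rw [integral_finsetSum _ fun q _ => (hff p.1 q.1).const_mul _]
    refine Finset.sum_congr rfl fun q _ => ?_
    rw [integral_const_mul, hW₀]
    simp only [Matrix.kroneckerMap_apply, Matrix.of_apply]
    ring
  have hsym : ∀ y z : Fin n → ℝ, y ⬝ᵥ U *ᵥ z = z ⬝ᵥ U *ᵥ y := by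
    intro y z
    have hS : U.IsSymm := by simpa using hU.1
    have hT : Uᵀ = U := hS
    rw [Matrix.dotProduct_mulVec, ← Matrix.mulVec_transpose, hT, dotProduct_comm]
  have key : 2 * (∫ τ in K, ϖ τ * (x τ ⬝ᵥ U *ᵥ v τ)) - (∫ τ in K, ϖ τ * (v τ ⬝ᵥ U *ᵥ v τ))
      ≤ ∫ τ in K, ϖ τ * (x τ ⬝ᵥ U *ᵥ x τ) := by
    rw [← integral_const_mul, ← integral_sub (iB.const_mul 2) iC]
    refine integral_mono ((iB.const_mul 2).sub iC) iA fun τ => ?_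
    have h0 : 0 ≤ (x τ - v τ) ⬝ᵥ U *ᵥ (x τ - v τ) := by
      simpa using hU.dotProduct_mulVec_nonneg (x τ - v τ)
    rw [Matrix.mulVec_sub, dotProduct_sub, sub_dotProduct, sub_dotProduct, hsym (v τ) (x τ)] at h0
    have := mul_nonneg (hϖ0 τ) h0
    simp only
    linarith
  rw [vB, vC]
  exact key
end

section
/- Under the stated hypotheses, let ρ ∈ ℕ, let U be a real symmetric positive semidefinite n×n matrix, and suppose Y ∈ ℝ^{ρdn×ρdn} symmetric and X = [X₁ ⋯ X_d] ∈ ℝ^{n×ρdn} (with blocks X_i ∈ ℝ^{n×ρn}) satisfy that the block matrix [[U, −X], [−Xᵀ, Y]] is positive semidefinite. Set X̂ := Col(X₁, …, X_d) ∈ ℝ^{dn×ρn} and W := ∫_K ϖ(τ) (f(τ)ᵀ ⊗ I_{ρn}) Y (f(τ) ⊗ I_{ρn}) dτ ∈ ℝ^{ρn×ρn}. Then for every z ∈ ℝ^{ρn}, ∫_K ϖ(τ) x(τ)ᵀ U x(τ) dτ ≥ 2 ϑᵀ X̂ z − zᵀ W z. -/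
open MeasureTheory Matrix
open scoped Kronecker

/-- `f(τ) ⊗ I_{ρn} ∈ ℝ^{dρn×ρn}`. -/
noncomputable def kronColIdRho (d n ρ : ℕ) (f : ℝ → Fin d → ℝ) (τ : ℝ) :
    Matrix (Fin d × (Fin ρ × Fin n)) (Fin ρ × Fin n) ℝ :=
  Matrix.of fun p q => f τ p.1 * (1 : Matrix (Fin ρ × Fin n) (Fin ρ × Fin n) ℝ) p.2 q

lemma aux_integrable (K : Set ℝ) (ϖ : ℝ → ℝ) (hϖ : Measurable ϖ) (hϖ0 : ∀ τ, 0 ≤ ϖ τ)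
    {a b : ℕ} (f : ℝ → Fin a → ℝ) (hf : Measurable f)
    (hfi : IntegrableOn (fun τ => ϖ τ * ‖f τ‖ ^ 2) K)
    (x : ℝ → Fin b → ℝ) (hx : Measurable x)
    (hxi : IntegrableOn (fun τ => ϖ τ * ‖x τ‖ ^ 2) K) (i : Fin a) (j : Fin b) :
    IntegrableOn (fun τ => ϖ τ * (f τ i * x τ j)) K := by
  have hfm : Measurable fun τ => f τ i := (measurable_pi_apply i).comp hf
  have hxm : Measurable fun τ => x τ j := (measurable_pi_apply j).comp hx
  refine Integrable.mono' (hfi.add hxi) ?_ ?_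
  · exact (hϖ.mul (hfm.mul hxm)).aestronglyMeasurable
  · refine Filter.Eventually.of_forall fun τ => ?_
    have h1 := norm_le_pi_norm (f τ) i
    have h2 := norm_le_pi_norm (x τ) j
    have h3 := norm_nonneg (f τ i)
    have h4 := norm_nonneg (x τ j)
    simp only [Pi.add_apply]
    rw [norm_mul, norm_mul, Real.norm_of_nonneg (hϖ0 τ), ← mul_add]
    refine mul_le_mul_of_nonneg_left ?_ (hϖ0 τ)
    have h5 := mul_le_mul h1 h2 h4 (h3.trans h1)
    nlinarith [sq_nonneg (‖f τ‖ - ‖x τ‖), sq_nonneg (‖f τ‖), sq_nonneg (‖x τ‖)]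

/-- Free-matrix type integral inequality: if `[[U, −X], [−Xᵀ, Y]] ⪰ 0`, then for all
`z ∈ ℝ^{ρn}`, `∫_K ϖ x ᵀU x ≥ 2 ϑᵀ X̂ z − zᵀ W z`. -/
theorem free_matrix_integral_inequality (d n ρ : ℕ) (K : Set ℝ)
    (hK : MeasurableSet K)
    (ϖ : ℝ → ℝ) (hϖ : Measurable ϖ) (hϖ0 : ∀ τ, 0 ≤ ϖ τ)
    (f : ℝ → Fin d → ℝ) (hf : Measurable f)
    (hfi : IntegrableOn (fun τ => ϖ τ * ‖f τ‖ ^ 2) K)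
    (W₀ : Matrix (Fin d) (Fin d) ℝ)
    (hW₀ : W₀ = Matrix.of fun i j => ∫ τ in K, ϖ τ * (f τ i * f τ j))
    (hW₀pd : W₀.PosDef)
    (x : ℝ → Fin n → ℝ) (hx : Measurable x)
    (hxi : IntegrableOn (fun τ => ϖ τ * ‖x τ‖ ^ 2) K)
    (ϑ : Fin d × Fin n → ℝ)
    (hϑ : ϑ = fun p => ∫ τ in K, ϖ τ * ((kronColId d n f τ *ᵥ x τ) p))
    (U : Matrix (Fin n) (Fin n) ℝ) (hU : U.PosSemidef)
    (Y : Matrix (Fin d × (Fin ρ × Fin n)) (Fin d × (Fin ρ × Fin n)) ℝ)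
    (hY : Y.IsSymm)
    (Xb : Fin d → Matrix (Fin n) (Fin ρ × Fin n) ℝ)
    (X : Matrix (Fin n) (Fin d × (Fin ρ × Fin n)) ℝ)
    (hX : X = Matrix.of fun i q => Xb q.1 i q.2)
    (hblock : (Matrix.fromBlocks U (-X) (-Xᵀ) Y).PosSemidef)
    (Xhat : Matrix (Fin d × Fin n) (Fin ρ × Fin n) ℝ)
    (hXhat : Xhat = Matrix.of fun p q => Xb p.1 p.2 q)
    (W : Matrix (Fin ρ × Fin n) (Fin ρ × Fin n) ℝ)
    (hW : W = Matrix.of fun a b => ∫ τ in K,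
      ϖ τ * (((kronColIdRho d n ρ f τ)ᵀ * Y * kronColIdRho d n ρ f τ) a b))
    (z : Fin ρ × Fin n → ℝ) :
    (∫ τ in K, ϖ τ * (x τ ⬝ᵥ U *ᵥ x τ)) ≥
      2 * (ϑ ⬝ᵥ Xhat *ᵥ z) - z ⬝ᵥ W *ᵥ z := by
  classical
  have hFx : ∀ τ p, (kronColId d n f τ *ᵥ x τ) p = f τ p.1 * x τ p.2 := by
    intro τ p
    simp [kronColId, Matrix.mulVec, dotProduct, Matrix.one_apply]
  have hFz : ∀ τ p, (kronColIdRho d n ρ f τ *ᵥ z) p = f τ p.1 * z p.2 := by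
    intro τ p
    simp only [kronColIdRho, Matrix.mulVec, dotProduct, Matrix.one_apply, Matrix.of_apply]
    simp
  have hA : IntegrableOn (fun τ => ϖ τ * (x τ ⬝ᵥ U *ᵥ x τ)) K := by
    have : (fun τ => ϖ τ * (x τ ⬝ᵥ U *ᵥ x τ)) =
        fun τ => ∑ i, ∑ j, (ϖ τ * (x τ i * x τ j)) * U i j := by
      funext τ
      simp only [dotProduct, Matrix.mulVec, Finset.mul_sum]
      exact Finset.sum_congr rfl fun i _ => Finset.sum_congr rfl fun j _ => by ring
    rw [this]
    exact integrable_finsetSum _ fun i _ => integrable_finsetSum _ fun j _ =>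
      (aux_integrable K ϖ hϖ hϖ0 x hx hxi x hx hxi i j).mul_const _
  have hBp : ∀ p, IntegrableOn (fun τ => ϖ τ * ((kronColId d n f τ *ᵥ x τ) p)) K := by
    intro p
    simp only [hFx]
    exact aux_integrable K ϖ hϖ hϖ0 f hf hfi x hx hxi p.1 p.2
  have hCp : ∀ a b, IntegrableOn (fun τ =>
      ϖ τ * (((kronColIdRho d n ρ f τ)ᵀ * Y * kronColIdRho d n ρ f τ) a b)) K := by
    intro a b
    have : (fun τ => ϖ τ * (((kronColIdRho d n ρ f τ)ᵀ * Y * kronColIdRho d n ρ f τ) a b)) =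
        fun τ => ∑ q, ∑ p, (ϖ τ * (f τ p.1 * f τ q.1)) *
          ((1 : Matrix (Fin ρ × Fin n) (Fin ρ × Fin n) ℝ) p.2 a * Y p q *
            (1 : Matrix (Fin ρ × Fin n) (Fin ρ × Fin n) ℝ) q.2 b) := by
      funext τ
      simp only [Matrix.mul_apply, Finset.mul_sum, Finset.sum_mul, Matrix.transpose_apply,
        kronColIdRho, Matrix.of_apply]
      exact Finset.sum_congr rfl fun i _ => Finset.sum_congr rfl fun j _ => by ring
    rw [this]
    exact integrable_finsetSum _ fun q _ => integrable_finsetSum _ fun p _ =>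
      (aux_integrable K ϖ hϖ hϖ0 f hf hfi f hf hfi p.1 q.1).mul_const _
  have hB : IntegrableOn (fun τ => ϖ τ * ((kronColId d n f τ *ᵥ x τ) ⬝ᵥ (Xhat *ᵥ z))) K ∧
      ∫ τ in K, ϖ τ * ((kronColId d n f τ *ᵥ x τ) ⬝ᵥ (Xhat *ᵥ z)) = ϑ ⬝ᵥ Xhat *ᵥ z := by
    generalize Xhat *ᵥ z = c
    have : (fun τ => ϖ τ * ((kronColId d n f τ *ᵥ x τ) ⬝ᵥ c)) =
        fun τ => ∑ p, (ϖ τ * ((kronColId d n f τ *ᵥ x τ) p)) * c p := by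
      funext τ
      simp only [dotProduct, Finset.mul_sum, mul_assoc]
    rw [this]
    refine ⟨integrable_finsetSum _ fun p _ => (hBp p).mul_const _, ?_⟩
    rw [integral_finsetSum _ fun p _ => (hBp p).mul_const _]
    simp only [integral_mul_const, hϑ, dotProduct]
  have hC : IntegrableOn (fun τ => ϖ τ * (z ⬝ᵥ
        ((kronColIdRho d n ρ f τ)ᵀ * Y * kronColIdRho d n ρ f τ) *ᵥ z)) K ∧
      ∫ τ in K, ϖ τ * (z ⬝ᵥ
        ((kronColIdRho d n ρ f τ)ᵀ * Y * kronColIdRho d n ρ f τ) *ᵥ z) = z ⬝ᵥ W *ᵥ z := by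
    have : (fun τ => ϖ τ * (z ⬝ᵥ
        ((kronColIdRho d n ρ f τ)ᵀ * Y * kronColIdRho d n ρ f τ) *ᵥ z)) =
        fun τ => ∑ a, ∑ b, (ϖ τ *
          (((kronColIdRho d n ρ f τ)ᵀ * Y * kronColIdRho d n ρ f τ) a b)) * (z a * z b) := by
      funext τ
      generalize (kronColIdRho d n ρ f τ)ᵀ * Y * kronColIdRho d n ρ f τ = M
      simp only [dotProduct, Matrix.mulVec, Finset.mul_sum]
      exact Finset.sum_congr rfl fun i _ => Finset.sum_congr rfl fun j _ => by ring
    rw [this]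
    have hi : ∀ a, IntegrableOn (fun τ => ∑ b, (ϖ τ *
          (((kronColIdRho d n ρ f τ)ᵀ * Y * kronColIdRho d n ρ f τ) a b)) * (z a * z b)) K :=
      fun a => integrable_finsetSum _ fun b _ => (hCp a b).mul_const _
    refine ⟨integrable_finsetSum _ fun a _ => hi a, ?_⟩
    rw [integral_finsetSum _ fun a _ => hi a]
    simp only [dotProduct, Matrix.mulVec, Finset.mul_sum]
    refine Finset.sum_congr rfl fun a _ => ?_
    rw [integral_finsetSum _ fun b _ => (hCp a b).mul_const _]
    refine Finset.sum_congr rfl fun b _ => ?_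
    rw [integral_mul_const, hW, Matrix.of_apply]
    ring
  have key : ∀ τ, 0 ≤ (x τ ⬝ᵥ U *ᵥ x τ) - 2 * ((kronColId d n f τ *ᵥ x τ) ⬝ᵥ (Xhat *ᵥ z))
      + z ⬝ᵥ ((kronColIdRho d n ρ f τ)ᵀ * Y * kronColIdRho d n ρ f τ) *ᵥ z := by
    intro τ
    have h := hblock.dotProduct_mulVec_nonneg (Sum.elim (x τ) (kronColIdRho d n ρ f τ *ᵥ z))
    have e1 : z ⬝ᵥ ((kronColIdRho d n ρ f τ)ᵀ * Y * kronColIdRho d n ρ f τ) *ᵥ z =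
        (kronColIdRho d n ρ f τ *ᵥ z) ⬝ᵥ Y *ᵥ (kronColIdRho d n ρ f τ *ᵥ z) := by
      rw [← Matrix.mulVec_mulVec, ← Matrix.mulVec_mulVec, Matrix.dotProduct_mulVec,
        Matrix.vecMul_transpose]
    have e2 : (kronColId d n f τ *ᵥ x τ) ⬝ᵥ (Xhat *ᵥ z) =
        x τ ⬝ᵥ X *ᵥ (kronColIdRho d n ρ f τ *ᵥ z) := by
      rw [funext (hFx τ), funext (hFz τ), hX, hXhat]
      simp only [dotProduct, Matrix.mulVec, Matrix.of_apply, Finset.mul_sum]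
      rw [Fintype.sum_prod_type, Finset.sum_comm]
      refine Finset.sum_congr rfl fun i _ => ?_
      rw [Fintype.sum_prod_type]
      exact Finset.sum_congr rfl fun i _ => Finset.sum_congr rfl fun j _ => by ring
    rw [e1, e2]
    generalize kronColIdRho d n ρ f τ *ᵥ z = w at h
    have e3 : w ⬝ᵥ Xᵀ *ᵥ x τ = x τ ⬝ᵥ X *ᵥ w := by
      rw [Matrix.dotProduct_mulVec, Matrix.vecMul_transpose, dotProduct_comm]
    rw [star_trivial, Matrix.fromBlocks_mulVec, sumElim_dotProduct_sumElim] at h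
    simp only [Sum.elim_comp_inl, Sum.elim_comp_inr, Matrix.neg_mulVec, dotProduct_add,
      dotProduct_neg, e3] at h
    linarith
  have h1 := integral_sub (hB.1.const_mul 2) hC.1
  have h2 : ∫ τ in K, (2 * (ϖ τ * ((kronColId d n f τ *ᵥ x τ) ⬝ᵥ (Xhat *ᵥ z))) - ϖ τ * (z ⬝ᵥ
        ((kronColIdRho d n ρ f τ)ᵀ * Y * kronColIdRho d n ρ f τ) *ᵥ z)) ≤
      ∫ τ in K, ϖ τ * (x τ ⬝ᵥ U *ᵥ x τ) := by
    refine integral_mono ((hB.1.const_mul 2).sub hC.1) hA fun τ => ?_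
    have := mul_nonneg (hϖ0 τ) (key τ)
    simp only
    linarith
  rw [integral_const_mul, hB.2, hC.2] at h1
  rw [ge_iff_le, ← h1]
  exact h2
end

section
/- Under the stated hypotheses, let ρ ∈ ℕ, let U be a real symmetric positive definite n×n matrix, let X = [X₁ ⋯ X_d] ∈ ℝ^{n×ρdn} with blocks X_i ∈ ℝ^{n×ρn}, and let Y ∈ ℝ^{ρdn×ρdn} be symmetric with Y ⪰ Xᵀ U⁻¹ X. Set X̂ := Col(X₁, …, X_d) ∈ ℝ^{dn×ρn} and W := ∫_K ϖ(τ) (f(τ)ᵀ ⊗ I_{ρn}) Y (f(τ) ⊗ I_{ρn}) dτ. Then W ⪰ X̂ᵀ (W₀ ⊗ U⁻¹) X̂, with equality when Y = Xᵀ U⁻¹ X. -/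
open MeasureTheory Matrix
open scoped Kronecker

theorem kron_entry (d n ρ : ℕ) (f : ℝ → Fin d → ℝ) (τ : ℝ)
    (Y : Matrix (Fin d × (Fin ρ × Fin n)) (Fin d × (Fin ρ × Fin n)) ℝ) (a b : Fin ρ × Fin n) :
    ((kronColIdRho d n ρ f τ)ᵀ * Y * kronColIdRho d n ρ f τ) a b
      = ∑ i, ∑ j, (f τ i * f τ j) * Y (i, a) (j, b) := by
  have h1 : ∀ q, ((kronColIdRho d n ρ f τ)ᵀ * Y) a q = ∑ i, f τ i * Y (i, a) q := by
    intro q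
    rw [Matrix.mul_apply, Fintype.sum_prod_type]
    refine Finset.sum_congr rfl fun i _ => ?_
    rw [Finset.sum_eq_single a]
    · simp [kronColIdRho]
    · intro c _ hc
      simp [kronColIdRho, Matrix.one_apply_ne hc]
    · simp
  rw [Matrix.mul_apply, Fintype.sum_prod_type, Finset.sum_comm' (t' := Finset.univ)
    (s' := fun _ => Finset.univ) (by simp), Finset.sum_eq_single b]
  · simp only [h1]
    rw [Finset.sum_comm]
    refine Finset.sum_congr rfl fun j _ => ?_
    rw [Finset.sum_mul]
    refine Finset.sum_congr rfl fun i _ => ?_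
    simp [kronColIdRho]
    ring
  · intro c _ hc
    simp [kronColIdRho, Matrix.one_apply_ne hc]
  · simp

/-- If `Y ⪰ Xᵀ U⁻¹ X`, then `W ⪰ X̂ᵀ (W₀ ⊗ U⁻¹) X̂`, with equality when
`Y = Xᵀ U⁻¹ X`. -/
theorem free_matrix_W_lower_bound (d n ρ : ℕ) (K : Set ℝ)
    (hK : MeasurableSet K)
    (ϖ : ℝ → ℝ) (hϖ : Measurable ϖ) (hϖ0 : ∀ τ, 0 ≤ ϖ τ)
    (f : ℝ → Fin d → ℝ) (hf : Measurable f)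
    (hfi : IntegrableOn (fun τ => ϖ τ * ‖f τ‖ ^ 2) K)
    (W₀ : Matrix (Fin d) (Fin d) ℝ)
    (hW₀ : W₀ = Matrix.of fun i j => ∫ τ in K, ϖ τ * (f τ i * f τ j))
    (hW₀pd : W₀.PosDef)
    (U : Matrix (Fin n) (Fin n) ℝ) (hU : U.PosDef)
    (Xb : Fin d → Matrix (Fin n) (Fin ρ × Fin n) ℝ)
    (X : Matrix (Fin n) (Fin d × (Fin ρ × Fin n)) ℝ)
    (hX : X = Matrix.of fun i q => Xb q.1 i q.2)
    (Y : Matrix (Fin d × (Fin ρ × Fin n)) (Fin d × (Fin ρ × Fin n)) ℝ)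
    (hY : Y.IsSymm)
    (hYge : (Y - Xᵀ * U⁻¹ * X).PosSemidef)
    (Xhat : Matrix (Fin d × Fin n) (Fin ρ × Fin n) ℝ)
    (hXhat : Xhat = Matrix.of fun p q => Xb p.1 p.2 q)
    (W : Matrix (Fin ρ × Fin n) (Fin ρ × Fin n) ℝ)
    (hW : W = Matrix.of fun a b => ∫ τ in K,
      ϖ τ * (((kronColIdRho d n ρ f τ)ᵀ * Y * kronColIdRho d n ρ f τ) a b)) :
    (W - Xhatᵀ * (W₀ ⊗ₖ U⁻¹) * Xhat).PosSemidef ∧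
      (Y = Xᵀ * U⁻¹ * X → W = Xhatᵀ * (W₀ ⊗ₖ U⁻¹) * Xhat) := by
  have hint : ∀ i j, IntegrableOn (fun τ => ϖ τ * (f τ i * f τ j)) K := by
    intro i j
    refine Integrable.mono hfi ?_ (Filter.Eventually.of_forall fun τ => ?_)
    · have hi : Measurable fun τ => f τ i := (measurable_pi_apply i).comp hf
      have hj : Measurable fun τ => f τ j := (measurable_pi_apply j).comp hf
      exact (hϖ.mul (hi.mul hj)).aestronglyMeasurable
    · rw [norm_mul, norm_mul, norm_mul, norm_pow, norm_norm, sq]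
      have h1 := norm_le_pi_norm (f τ) i
      have h2 := norm_le_pi_norm (f τ) j
      gcongr
  have hWe : ∀ a b, W a b = ∑ i, ∑ j, W₀ i j * Y (i, a) (j, b) := by
    intro a b
    rw [hW, hW₀]
    simp only [Matrix.of_apply, kron_entry, Finset.mul_sum]
    rw [integral_finsetSum]
    · refine Finset.sum_congr rfl fun i _ => ?_
      rw [integral_finsetSum]
      · refine Finset.sum_congr rfl fun j _ => ?_
        rw [← integral_mul_const]
        simp only [mul_assoc]
      · intro j _
        simpa only [mul_assoc] using (hint i j).mul_const (Y (i, a) (j, b))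
    · intro i _
      refine integrable_finsetSum _ fun j _ => ?_
      simpa only [mul_assoc] using (hint i j).mul_const (Y (i, a) (j, b))
  have hXe : ∀ a b, (Xhatᵀ * (W₀ ⊗ₖ U⁻¹) * Xhat) a b
      = ∑ i, ∑ j, W₀ i j * (Xᵀ * U⁻¹ * X) (i, a) (j, b) := by
    intro a b
    rw [hX, hXhat]
    simp only [Matrix.mul_apply, Fintype.sum_prod_type, Matrix.transpose_apply, Matrix.of_apply,
      Matrix.kroneckerMap_apply, Finset.mul_sum, Finset.sum_mul]
    conv_rhs => rw [Finset.sum_comm]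
    refine Finset.sum_congr rfl fun j _ => ?_
    rw [Finset.sum_comm]
    refine Finset.sum_congr rfl fun i _ => ?_
    refine Finset.sum_congr rfl fun s _ => ?_
    refine Finset.sum_congr rfl fun r _ => ?_
    ring
  have hD : ∀ a b, (W - Xhatᵀ * (W₀ ⊗ₖ U⁻¹) * Xhat) a b
      = ∑ i, ∑ j, W₀ i j * (Y - Xᵀ * U⁻¹ * X) (i, a) (j, b) := by
    intro a b
    rw [Matrix.sub_apply, hWe, hXe]
    simp only [Matrix.sub_apply, mul_sub, Finset.sum_sub_distrib]
  constructor
  · obtain ⟨m, v, hB⟩ := Matrix.posSemidef_iff_eq_sum_vecMulVec.1 hW₀pd.posSemidef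
    have : W - Xhatᵀ * (W₀ ⊗ₖ U⁻¹) * Xhat = ∑ k, (kronColIdRho d n ρ (fun _ => v k) 0)ᴴ *
        (Y - Xᵀ * U⁻¹ * X) * kronColIdRho d n ρ (fun _ => v k) 0 := by
      ext a b
      rw [hD, Matrix.sum_apply]
      simp only [Matrix.conjTranspose_eq_transpose_of_trivial, kron_entry]
      conv_rhs => rw [Finset.sum_comm]
      refine Finset.sum_congr rfl fun i _ => ?_
      conv_rhs => rw [Finset.sum_comm]
      refine Finset.sum_congr rfl fun j _ => ?_
      rw [← Finset.sum_mul]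
      congr 1
      rw [hB]
      simp [Matrix.sum_apply, Matrix.vecMulVec_apply]
    rw [this]
    exact Matrix.posSemidef_sum _ fun k _ => hYge.conjTranspose_mul_mul_same _
  · intro h
    ext a b
    rw [hWe, hXe, h]
end

section
/- Under the stated hypotheses, let ρ ∈ ℕ, let U be a real symmetric positive definite n×n matrix, and let X̂ ∈ ℝ^{dn×ρn} be arbitrary. If Υ ∈ ℝ^{dn×ρn} and z ∈ ℝ^{ρn} satisfy Υ z = ϑ, then ∫_K ϖ(τ) x(τ)ᵀ U x(τ) dτ ≥ zᵀ (Υᵀ X̂ + X̂ᵀ Υ − X̂ᵀ (W₀ ⊗ U⁻¹) X̂) z. -/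
open MeasureTheory Matrix
open scoped Kronecker

lemma aux_int_s15 {a b : ℕ} {K : Set ℝ} {w : ℝ → ℝ} (hw : Measurable w) (hw0 : ∀ τ, 0 ≤ w τ)
    {u : ℝ → Fin a → ℝ} {v : ℝ → Fin b → ℝ} (hu : Measurable u) (hv : Measurable v)
    (hui : IntegrableOn (fun τ => w τ * ‖u τ‖ ^ 2) K)
    (hvi : IntegrableOn (fun τ => w τ * ‖v τ‖ ^ 2) K) (i : Fin a) (j : Fin b) :
    IntegrableOn (fun τ => w τ * (u τ i * v τ j)) K := by
  refine Integrable.mono' (hui.add hvi) ?_ (Filter.Eventually.of_forall fun τ => ?_)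
  · exact (hw.mul (((measurable_pi_apply i).comp hu).mul
      ((measurable_pi_apply j).comp hv))).aestronglyMeasurable
  · have h1 := norm_le_pi_norm (u τ) i
    have h2 := norm_le_pi_norm (v τ) j
    have h3 : ‖u τ i‖ * ‖v τ j‖ ≤ ‖u τ‖ * ‖v τ‖ := by gcongr
    have h4 : ‖u τ‖ * ‖v τ‖ ≤ ‖u τ‖ ^ 2 + ‖v τ‖ ^ 2 := by
      nlinarith [sq_nonneg (‖u τ‖ - ‖v τ‖), sq_nonneg (‖u τ‖), sq_nonneg (‖v τ‖)]
    have h5 := mul_le_mul_of_nonneg_left (h3.trans h4) (hw0 τ)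
    simp only [norm_mul, Pi.add_apply, Real.norm_of_nonneg (hw0 τ)]
    linarith

lemma aux_pt {n : ℕ} {U : Matrix (Fin n) (Fin n) ℝ} (hU : U.PosDef) (x g : Fin n → ℝ) :
    2 * (g ⬝ᵥ x) - g ⬝ᵥ U⁻¹ *ᵥ g ≤ x ⬝ᵥ U *ᵥ x := by
  have h := hU.posSemidef.dotProduct_mulVec_nonneg (x - U⁻¹ *ᵥ g)
  have hdet : IsUnit U.det := (Matrix.isUnit_iff_isUnit_det U).1 hU.isUnit
  have hT : Uᵀ = U := by simpa [Matrix.IsHermitian, conjTranspose_eq_transpose_of_trivial] using hU.isHermitian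
  have e1 : U *ᵥ (U⁻¹ *ᵥ g) = g := by
    rw [mulVec_mulVec, Matrix.mul_nonsing_inv _ hdet, one_mulVec]
  have e2 : (U⁻¹ *ᵥ g) ⬝ᵥ U *ᵥ x = g ⬝ᵥ x := by
    rw [dotProduct_mulVec, ← mulVec_transpose, hT, e1]
  rw [star_trivial, mulVec_sub, e1, sub_dotProduct, dotProduct_sub, dotProduct_sub, e2,
    dotProduct_comm x g, dotProduct_comm (U⁻¹ *ᵥ g) g] at h
  linarith

/-- For `U ≻ 0`, any `X̂ ∈ ℝ^{dn×ρn}`, and `Υ z = ϑ`: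
`∫_K ϖ xᵀ U x ≥ zᵀ (Υᵀ X̂ + X̂ᵀ Υ − X̂ᵀ (W₀ ⊗ U⁻¹) X̂) z`. -/
theorem reduced_free_matrix_integral_inequality (d n ρ : ℕ) (K : Set ℝ)
    (hK : MeasurableSet K)
    (ϖ : ℝ → ℝ) (hϖ : Measurable ϖ) (hϖ0 : ∀ τ, 0 ≤ ϖ τ)
    (f : ℝ → Fin d → ℝ) (hf : Measurable f)
    (hfi : IntegrableOn (fun τ => ϖ τ * ‖f τ‖ ^ 2) K)
    (W₀ : Matrix (Fin d) (Fin d) ℝ)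
    (hW₀ : W₀ = Matrix.of fun i j => ∫ τ in K, ϖ τ * (f τ i * f τ j))
    (hW₀pd : W₀.PosDef)
    (x : ℝ → Fin n → ℝ) (hx : Measurable x)
    (hxi : IntegrableOn (fun τ => ϖ τ * ‖x τ‖ ^ 2) K)
    (ϑ : Fin d × Fin n → ℝ)
    (hϑ : ϑ = fun p => ∫ τ in K, ϖ τ * ((kronColId d n f τ *ᵥ x τ) p))
    (U : Matrix (Fin n) (Fin n) ℝ) (hU : U.PosDef)
    (Xhat : Matrix (Fin d × Fin n) (Fin ρ × Fin n) ℝ)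
    (Υ : Matrix (Fin d × Fin n) (Fin ρ × Fin n) ℝ)
    (z : Fin ρ × Fin n → ℝ) (hΥz : Υ *ᵥ z = ϑ) :
    (∫ τ in K, ϖ τ * (x τ ⬝ᵥ U *ᵥ x τ)) ≥
      z ⬝ᵥ (Υᵀ * Xhat + Xhatᵀ * Υ - Xhatᵀ * (W₀ ⊗ₖ U⁻¹) * Xhat) *ᵥ z := by
  set y := Xhat *ᵥ z with hy
  have hR : z ⬝ᵥ (Υᵀ * Xhat + Xhatᵀ * Υ - Xhatᵀ * (W₀ ⊗ₖ U⁻¹) * Xhat) *ᵥ z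
      = 2 * (y ⬝ᵥ ϑ) - y ⬝ᵥ (W₀ ⊗ₖ U⁻¹) *ᵥ y := by
    rw [sub_mulVec, add_mulVec, dotProduct_sub, dotProduct_add, Matrix.mul_assoc,
      ← mulVec_mulVec, ← mulVec_mulVec, ← mulVec_mulVec, ← mulVec_mulVec, hΥz, ← hy,
      dotProduct_mulVec z Υᵀ, dotProduct_mulVec z Xhatᵀ, dotProduct_mulVec z Xhatᵀ,
      vecMul_transpose, vecMul_transpose, hΥz, ← hy, dotProduct_comm ϑ y]
    ring
  have hF : ∀ τ p, (kronColId d n f τ *ᵥ x τ) p = f τ p.1 * x τ p.2 := by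
    intro τ p
    simp [kronColId, mulVec, dotProduct, Matrix.one_apply]
  have hfx := aux_int_s15 hϖ hϖ0 hf hx hfi hxi
  have hff := aux_int_s15 hϖ hϖ0 hf hf hfi hfi
  have hxx := aux_int_s15 hϖ hϖ0 hx hx hxi hxi
  have i1 : ∀ p ∈ (Finset.univ : Finset (Fin d × Fin n)), Integrable
      (fun τ => 2 * y p * (ϖ τ * (f τ p.1 * x τ p.2))) (volume.restrict K) :=
    fun p _ => (hfx p.1 p.2).const_mul _
  have i2 : ∀ p ∈ (Finset.univ : Finset (Fin d × Fin n)),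
      ∀ q ∈ (Finset.univ : Finset (Fin d × Fin n)), Integrable
      (fun τ => y p * U⁻¹ p.2 q.2 * y q * (ϖ τ * (f τ p.1 * f τ q.1))) (volume.restrict K) :=
    fun p _ q _ => (hff p.1 q.1).const_mul _
  have i2' := fun p hp => integrable_finsetSum _ (i2 p hp)
  have i3 : Integrable (fun τ => ϖ τ * (x τ ⬝ᵥ U *ᵥ x τ)) (volume.restrict K) := by
    have : (fun τ => ϖ τ * (x τ ⬝ᵥ U *ᵥ x τ))
        = fun τ => ∑ i, ∑ j, U i j * (ϖ τ * (x τ i * x τ j)) := by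
      funext τ
      simp only [dotProduct, mulVec, Finset.mul_sum]
      refine Finset.sum_congr rfl fun i _ => Finset.sum_congr rfl fun j _ => by ring
    rw [this]
    exact integrable_finsetSum _ fun i _ => integrable_finsetSum _ fun j _ =>
      (hxx i j).const_mul _
  have hI : 2 * (y ⬝ᵥ ϑ) - y ⬝ᵥ (W₀ ⊗ₖ U⁻¹) *ᵥ y = ∫ τ in K,
      ((∑ p, 2 * y p * (ϖ τ * (f τ p.1 * x τ p.2))) -
        ∑ p, ∑ q, y p * U⁻¹ p.2 q.2 * y q * (ϖ τ * (f τ p.1 * f τ q.1))) := by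
    rw [integral_sub (integrable_finsetSum _ i1) (integrable_finsetSum _ i2'),
      integral_finsetSum _ i1, integral_finsetSum _ i2']
    congr 1
    · simp only [integral_const_mul, dotProduct, Finset.mul_sum, hϑ, hF, mul_assoc]
    · simp only [dotProduct, mulVec, Finset.mul_sum]
      refine Finset.sum_congr rfl fun p hp => ?_
      rw [integral_finsetSum _ (i2 p hp)]
      refine Finset.sum_congr rfl fun q _ => ?_
      rw [integral_const_mul, kroneckerMap_apply, hW₀, of_apply]
      ring
  rw [hR, hI]
  refine integral_mono ((integrable_finsetSum _ i1).sub (integrable_finsetSum _ i2')) i3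
    fun τ => ?_
  have h := mul_le_mul_of_nonneg_left
    (aux_pt hU (x τ) (fun j => ∑ i, f τ i * y (i, j))) (hϖ0 τ)
  refine le_trans (le_of_eq ?_) h
  rw [mul_sub]
  simp only [dotProduct, mulVec, Finset.mul_sum, Finset.sum_mul, Fintype.sum_prod_type]
  congr 1
  · rw [Finset.sum_comm]
    refine Finset.sum_congr rfl fun i _ => Finset.sum_congr rfl fun j _ => by ring
  · rw [Finset.sum_comm]
    refine Finset.sum_congr rfl fun j _ => ?_
    refine Finset.sum_comm.trans (Eq.trans ?_ Finset.sum_comm)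
    refine Finset.sum_congr rfl fun l _ => Finset.sum_comm.trans ?_
    refine Finset.sum_congr rfl fun k _ => Finset.sum_congr rfl fun i _ => by ring
end
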